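/- Let m ≥ 2 and D, E, F ⊆ [m] with |D| = |E| = |F| = n where 0 ≤ n ≤ m−2. Then the minimum nonzero Lee weight of C_L equals (2^m − 2^n)·2^m·(2^m − 2^(n+1)) and the maximum Lee weight of C_L equals (2^m − 2^n)^2·2^m. -/

import Mathlib

open Finset

/-- The ring Z_2[u] with u² = 0: dual numbers over Z_2. -/
abbrev R2 : Type := DualNumber (ZMod 2)

/-- The support of a vector in Z_2^m, as a finset of coordinates. -/
def suppF {m : ℕ} (w : Fin m → ZMod 2) : Finset (Fin m) :=
  Finset.univ.filter fun i => w i ≠ 0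

/-- Inner product ⟨x,y⟩ = Σ_i x_i y_i in Z_2. -/
def ip {m : ℕ} (x y : Fin m → ZMod 2) : ZMod 2 := ∑ i, x i * y i

/-- The defining set L = Δ_D^c × Δ_E^c × Δ_F^c, parametrized by triples (t₁,t₂,t₃). -/
def Lset (m : ℕ) (D E F : Finset (Fin m)) :
    Finset ((Fin m → ZMod 2) × (Fin m → ZMod 2) × (Fin m → ZMod 2)) :=
  Finset.univ.filter fun t => ¬ suppF t.1 ⊆ D ∧ ¬ suppF t.2.1 ⊆ E ∧ ¬ suppF t.2.2 ⊆ F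

/-- The codeword c_a = (a·l)_{l∈L} for a = (p, q+ur), where
a·l = ⟨q,t₂⟩ + u(⟨p,t₁⟩ + ⟨q,t₃⟩ + ⟨r,t₂⟩). -/
def cword {m : ℕ} (D E F : Finset (Fin m)) (p q r : Fin m → ZMod 2) :
    ↥(Lset m D E F) → R2 := fun l =>
  TrivSqZeroExt.inl (ip q l.val.2.1) +
    TrivSqZeroExt.inr (ip p l.val.1 + ip q l.val.2.2 + ip r l.val.2.1)

/-- Lee weight of a single element q + ur of Z_2[u]: wt_H(r) + wt_H(q+r). -/
def leeWtOne (x : R2) : ℕ :=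
  (if TrivSqZeroExt.snd x ≠ 0 then 1 else 0) +
    (if TrivSqZeroExt.fst x + TrivSqZeroExt.snd x ≠ 0 then 1 else 0)

/-- Lee weight of a vector over Z_2[u]: sum of coordinate Lee weights. -/
def leeWt {ι : Type} [Fintype ι] (c : ι → R2) : ℕ := ∑ i, leeWtOne (c i)

/-- The Gray map: coordinatewise q + ur ↦ (r, q + r). -/
def gray {ι : Type} (c : ι → R2) : ι ⊕ ι → ZMod 2 :=
  Sum.elim (fun i => TrivSqZeroExt.snd (c i))
    (fun i => TrivSqZeroExt.fst (c i) + TrivSqZeroExt.snd (c i))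

/-- The code C_L as a set of words over Z_2[u] indexed by L. -/
def CL (m : ℕ) (D E F : Finset (Fin m)) : Set (↥(Lset m D E F) → R2) :=
  { c | ∃ p q r : Fin m → ZMod 2, c = cword D E F p q r }

/-- The nontrivial additive character of `ZMod 2`, with values in `ℤ`. -/
def signChar (x : ZMod 2) : ℤ := if x = 0 then 1 else -1

lemma signChar_add (x y : ZMod 2) : signChar (x + y) = signChar x * signChar y := by
  revert x y
  decide

lemma signChar_sum {ι : Type*} (s : Finset ι) (f : ι → ZMod 2) :
    signChar (∑ i ∈ s, f i) = ∏ i ∈ s, signChar (f i) := by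
  classical
  induction s using Finset.induction_on with
  | empty => simp [signChar]
  | insert a s ha ih => rw [Finset.sum_insert ha, Finset.prod_insert ha, signChar_add, ih]

lemma two_mul_leeWtOne (x : R2) :
    2 * (leeWtOne x : ℤ) =
      2 - signChar (TrivSqZeroExt.snd x) -
        signChar (TrivSqZeroExt.fst x + TrivSqZeroExt.snd x) := by
  unfold leeWtOne
  generalize TrivSqZeroExt.snd x = s
  generalize TrivSqZeroExt.fst x = f
  revert s f
  decide

lemma sum_signChar_subset {m : ℕ} (S : Finset (Fin m)) (v : Fin m → ZMod 2) :
    ∑ t with suppF t ⊆ S, signChar (ip v t) =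
      if ∀ i ∈ S, v i = 0 then 2 ^ S.card else 0 := by
  have hset : (Finset.univ.filter fun t : Fin m → ZMod 2 => suppF t ⊆ S) =
      Fintype.piFinset fun i => if i ∈ S then (Finset.univ : Finset (ZMod 2)) else {0} := by
    ext t
    simp only [Finset.mem_filter, Finset.mem_univ, true_and, Fintype.mem_piFinset,
      Finset.subset_iff, suppF]
    refine forall_congr' fun i => ?_
    by_cases hi : i ∈ S <;> simp [hi]
  have hfactor (i : Fin m) :
      ∑ x ∈ (if i ∈ S then (Finset.univ : Finset (ZMod 2)) else {0}), signChar (v i * x) =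
        if i ∈ S then (if v i = 0 then 2 else 0) else 1 := by
    by_cases hi : i ∈ S
    · simp only [hi, if_true]
      generalize v i = y
      revert y
      decide
    · simp [hi, signChar]
  simp only [ip, signChar_sum]
  rw [hset, ← Finset.prod_univ_sum (f := fun i x => signChar (v i * x)),
    Finset.prod_congr rfl fun i _ => hfactor i,
    Finset.prod_ite_mem, Finset.univ_inter]
  split_ifs with h
  · rw [Finset.prod_congr rfl fun i hi => if_pos (h i hi), Finset.prod_const]
  · push Not at h
    obtain ⟨i, hi, hv⟩ := h
    exact Finset.prod_eq_zero hi (if_neg hv)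

/-- The character sum attached to `v` over the complement of the simplicial complex of `S`. -/
def complCharSum {m : ℕ} (S : Finset (Fin m)) (v : Fin m → ZMod 2) : ℤ :=
  ∑ t with ¬ suppF t ⊆ S, signChar (ip v t)

lemma complCharSum_eq {m : ℕ} (S : Finset (Fin m)) (v : Fin m → ZMod 2) :
    complCharSum S v =
      (if v = 0 then 2 ^ m else 0) - if ∀ i ∈ S, v i = 0 then 2 ^ S.card else 0 := by
  have hall := sum_signChar_subset Finset.univ v
  simp only [Finset.subset_univ, Finset.filter_true, Finset.mem_univ, true_imp_iff,
    Finset.card_univ, Fintype.card_fin] at hall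
  have hsplit := Finset.sum_filter_add_sum_filter_not Finset.univ
    (fun t : Fin m → ZMod 2 => suppF t ⊆ S) (fun t => signChar (ip v t))
  rw [sum_signChar_subset, hall] at hsplit
  simp only [funext_iff, Pi.zero_apply, complCharSum]
  linarith

lemma complCharSum_zero {m : ℕ} (S : Finset (Fin m)) :
    complCharSum S 0 = 2 ^ m - 2 ^ S.card := by
  simp [complCharSum_eq]

lemma complCharSum_of_ne_zero {m : ℕ} (S : Finset (Fin m)) {v : Fin m → ZMod 2} (hv : v ≠ 0) :
    complCharSum S v = 0 ∨ complCharSum S v = -2 ^ S.card := by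
  rw [complCharSum_eq, if_neg hv]
  split_ifs <;> simp

lemma exists_complCharSum_eq_neg {m : ℕ} (S : Finset (Fin m)) (hS : S.card < m) :
    ∃ v : Fin m → ZMod 2, complCharSum S v = -2 ^ S.card := by
  obtain ⟨j, hj⟩ : ∃ j, j ∉ S := by
    by_contra! h
    rw [Finset.eq_univ_of_forall h, Finset.card_univ, Fintype.card_fin] at hS
    exact lt_irrefl _ hS
  refine ⟨Pi.single j 1, ?_⟩
  have hdisj : ∀ i ∈ S, (Pi.single j 1 : Fin m → ZMod 2) i = 0 := fun i hi =>
    Pi.single_eq_of_ne (ne_of_mem_of_not_mem hi hj) _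
  rw [complCharSum_eq, if_neg (by simp), if_pos hdisj, zero_sub]

lemma ip_zero_left {m : ℕ} (x : Fin m → ZMod 2) : ip 0 x = 0 := by
  simp [ip]

lemma ip_add_left {m : ℕ} (x y z : Fin m → ZMod 2) : ip (x + y) z = ip x z + ip y z := by
  simp [ip, add_mul, Finset.sum_add_distrib]

lemma Lset_eq_product {m : ℕ} (D E F : Finset (Fin m)) :
    Lset m D E F = (Finset.univ.filter fun t => ¬ suppF t ⊆ D) ×ˢ
      (Finset.univ.filter fun t => ¬ suppF t ⊆ E) ×ˢ
        (Finset.univ.filter fun t => ¬ suppF t ⊆ F) := by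
  ext ⟨t₁, t₂, t₃⟩
  simp [Lset]

lemma sum_Lset_signChar {m : ℕ} (D E F : Finset (Fin m)) (p q r : Fin m → ZMod 2) :
    ∑ t ∈ Lset m D E F, signChar (ip p t.1 + ip q t.2.2 + ip r t.2.1) =
      complCharSum D p * complCharSum F q * complCharSum E r := by
  rw [mul_assoc, mul_comm (complCharSum F q), complCharSum, complCharSum, complCharSum,
    Finset.sum_mul_sum, Finset.sum_mul, Lset_eq_product, Finset.sum_product]
  refine Finset.sum_congr rfl fun t₁ _ => ?_
  rw [Finset.sum_product, Finset.mul_sum]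
  refine Finset.sum_congr rfl fun t₂ _ => ?_
  rw [Finset.mul_sum]
  refine Finset.sum_congr rfl fun t₃ _ => ?_
  rw [signChar_add, signChar_add]
  ring

lemma two_mul_leeWt_cword {m : ℕ} (D E F : Finset (Fin m)) (p q r : Fin m → ZMod 2) :
    2 * (leeWt (cword D E F p q r) : ℤ) =
      2 * (complCharSum D 0 * complCharSum F 0 * complCharSum E 0) -
        complCharSum D p * complCharSum F q *
          (complCharSum E r + complCharSum E (q + r)) := by
  rw [mul_add, ← sum_Lset_signChar, ← sum_Lset_signChar, ← sum_Lset_signChar, leeWt,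
    Nat.cast_sum, Finset.mul_sum, Finset.mul_sum, ← Finset.sum_add_distrib,
    ← Finset.sum_sub_distrib, ← Finset.sum_coe_sort (Lset m D E F)]
  refine Finset.sum_congr rfl fun l _ => ?_
  rw [two_mul_leeWtOne]
  simp only [cword, TrivSqZeroExt.snd_add, TrivSqZeroExt.snd_inl, TrivSqZeroExt.snd_inr,
    TrivSqZeroExt.fst_add, TrivSqZeroExt.fst_inl, TrivSqZeroExt.fst_inr, ip_zero_left,
    ip_add_left, zero_add, add_zero]
  rw [show ip q l.val.2.1 + (ip p l.val.1 + ip q l.val.2.2 + ip r l.val.2.1) =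
    ip p l.val.1 + ip q l.val.2.2 + (ip q l.val.2.1 + ip r l.val.2.1) by ring]
  simp only [signChar, if_true]
  ring

lemma cword_zero {m : ℕ} (D E F : Finset (Fin m)) : cword D E F 0 0 0 = 0 := by
  funext l
  simp [cword, ip_zero_left]

lemma leeWt_cword_bounds {m n M : ℕ} {D E F : Finset (Fin m)} (hD : D.card = n)
    (hE : E.card = n) (hF : F.card = n) (hM : 2 ^ m = M + 2 ^ n) (hkM : 3 * 2 ^ n ≤ M)
    {p q r : Fin m → ZMod 2} (hne : ¬ (p = 0 ∧ q = 0 ∧ r = 0)) :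
    (M : ℤ) * (M + 2 ^ n) * (M - 2 ^ n) ≤ leeWt (cword D E F p q r) ∧
      (leeWt (cword D E F p q r) : ℤ) ≤ M ^ 2 * (M + 2 ^ n) := by
  have hw := two_mul_leeWt_cword D E F p q r
  have hM' : (2 : ℤ) ^ m = M + 2 ^ n := by exact_mod_cast hM
  have hk : (0 : ℤ) < 2 ^ n := by positivity
  have hkM' : 3 * (2 : ℤ) ^ n ≤ M := by exact_mod_cast hkM
  have hzero (S : Finset (Fin m)) (hS : S.card = n) : complCharSum S 0 = M := by
    rw [complCharSum_zero, hS, hM', add_sub_cancel_right]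
  have hcases (S : Finset (Fin m)) (hS : S.card = n) (v : Fin m → ZMod 2) :
      v = 0 ∧ complCharSum S v = M ∨
        v ≠ 0 ∧ (complCharSum S v = 0 ∨ complCharSum S v = -2 ^ n) := by
    rcases eq_or_ne v 0 with rfl | hv
    · exact Or.inl ⟨rfl, hzero S hS⟩
    · exact Or.inr ⟨hv, hS ▸ complCharSum_of_ne_zero S hv⟩
  rw [hzero D hD, hzero E hE, hzero F hF] at hw
  have hp := hcases D hD p
  have hq := hcases F hF q
  have hr := hcases E hE r
  have hqr := hcases E hE (q + r)
  generalize (2 : ℤ) ^ n = k at *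
  obtain ⟨j, hj, hMj⟩ : ∃ j : ℤ, 0 ≤ j ∧ (M : ℤ) = 3 * k + j :=
    ⟨M - 3 * k, by linarith, by ring⟩
  have hk3 : 0 < k ^ 3 := by positivity
  have hjk2 : 0 ≤ j * k ^ 2 := by positivity
  have hj2k : 0 ≤ j ^ 2 * k := by positivity
  have hj3 : 0 ≤ j ^ 3 := by positivity
  rw [hMj] at hw hp hq hr hqr ⊢
  clear hzero hcases hkM' hM'
  rcases hq with ⟨rfl, hq⟩ | ⟨hq0, hq⟩
  · rw [zero_add] at hw
    rcases hp with ⟨rfl, hp⟩ | ⟨-, hp | hp⟩ <;>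
      rcases hr with ⟨rfl, hr⟩ | ⟨-, hr | hr⟩ <;>
      first
        | exact absurd ⟨rfl, rfl, rfl⟩ hne
        | (rw [hp, hq, hr] at hw; constructor <;> linarith)
  · rcases hr with ⟨rfl, hr⟩ | ⟨-, hr | hr⟩ <;>
      rcases hqr with ⟨hqr0, hqr⟩ | ⟨-, hqr | hqr⟩ <;>
      first
        | exact absurd ((add_zero q).symm.trans hqr0) hq0
        | (rcases hp with ⟨-, hp⟩ | ⟨-, hp | hp⟩ <;> rcases hq with hq | hq <;>
            (rw [hp, hq, hr, hqr] at hw; constructor <;> linarith))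

/-- for |D| = |E| = |F| = n ≤ m−2, the minimum nonzero Lee weight of C_L
is (2^m − 2^n)·2^m·(2^m − 2^(n+1)) and the maximum Lee weight is (2^m − 2^n)²·2^m. -/
theorem stmt17 (m n : ℕ) (hm : 2 ≤ m) (hn : n ≤ m - 2) (D E F : Finset (Fin m))
    (hD : D.card = n) (hE : E.card = n) (hF : F.card = n) :
    IsLeast {w : ℕ | ∃ c ∈ CL m D E F, c ≠ 0 ∧ leeWt c = w}
      ((2 ^ m - 2 ^ n) * 2 ^ m * (2 ^ m - 2 ^ (n + 1))) ∧
    IsGreatest {w : ℕ | ∃ c ∈ CL m D E F, leeWt c = w}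
      ((2 ^ m - 2 ^ n) ^ 2 * 2 ^ m) := by
  obtain ⟨j, hj⟩ := Nat.exists_eq_add_of_le hn
  obtain rfl : m = n + j + 2 := by omega
  set k := 2 ^ n with hk
  obtain ⟨M, hM⟩ : ∃ M, 2 ^ (n + j + 2) = M + k := ⟨2 ^ (n + j + 2) - k, by
    have := Nat.pow_le_pow_right two_pos (show n ≤ n + j + 2 by omega)
    omega⟩
  have hkM : 3 * k ≤ M := by
    have := Nat.pow_le_pow_right two_pos (show n + 2 ≤ n + j + 2 by omega)
    rw [pow_add 2 n 2] at this
    omega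
  have hkpos : 0 < k := by positivity
  have hmin : (2 ^ (n + j + 2) - 2 ^ n) * 2 ^ (n + j + 2) *
      (2 ^ (n + j + 2) - 2 ^ (n + 1)) = M * (M + k) * (M - k) := by
    rw [hM, pow_succ 2 n, ← hk, Nat.add_sub_cancel, show M + k - k * 2 = M - k by omega]
  have hmax : (2 ^ (n + j + 2) - 2 ^ n) ^ 2 * 2 ^ (n + j + 2) = M ^ 2 * (M + k) := by
    rw [hM, ← hk, Nat.add_sub_cancel]
  have hkle : k ≤ M := by omega
  have hkcast : ((k : ℕ) : ℤ) = 2 ^ n := by simp [hk]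
  have hMcast : (2 : ℤ) ^ (n + j + 2) = M + k := by exact_mod_cast hM
  have hzero (S : Finset (Fin (n + j + 2))) (hS : S.card = n) : complCharSum S 0 = M := by
    rw [complCharSum_zero, hS, hMcast, hkcast, add_sub_cancel_right]
  rw [hmin, hmax]
  obtain ⟨p, hp⟩ := exists_complCharSum_eq_neg D (by omega)
  obtain ⟨r, hr⟩ := exists_complCharSum_eq_neg E (by omega)
  rw [hD, ← hkcast] at hp
  rw [hE, ← hkcast] at hr
  refine ⟨⟨?_, ?_⟩, ?_, ?_⟩
  · have hw : leeWt (cword D E F p 0 r) = M * (M + k) * (M - k) := by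
      have h := two_mul_leeWt_cword D E F p 0 r
      rw [zero_add, hzero D hD, hzero E hE, hzero F hF, hp, hr] at h
      zify [hkle]
      linarith
    refine ⟨_, ⟨p, 0, r, rfl⟩, fun h0 => ?_, hw⟩
    have hpos : 0 < M * (M + k) * (M - k) :=
      Nat.mul_pos (Nat.mul_pos (by omega) (by omega)) (by omega)
    rw [← hw, h0] at hpos
    simp [leeWt, leeWtOne] at hpos
  · rintro _ ⟨_, ⟨p, q, r, rfl⟩, hne, rfl⟩
    have h := (leeWt_cword_bounds (p := p) (q := q) (r := r) hD hE hF hM hkM ?_).1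
    · rw [← hkcast] at h
      zify [hkle]
      exact h
    · rintro ⟨rfl, rfl, rfl⟩
      exact hne (cword_zero D E F)
  · refine ⟨_, ⟨0, 0, r, rfl⟩, ?_⟩
    have h := two_mul_leeWt_cword D E F 0 0 r
    rw [zero_add, hzero D hD, hzero E hE, hzero F hF, hr] at h
    zify
    linarith
  · rintro _ ⟨_, ⟨p, q, r, rfl⟩, rfl⟩
    by_cases h0 : p = 0 ∧ q = 0 ∧ r = 0
    · obtain ⟨rfl, rfl, rfl⟩ := h0
      simp [cword_zero, leeWt, leeWtOne]
    · have h := (leeWt_cword_bounds hD hE hF hM hkM h0).2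
      rw [← hkcast] at h
      exact_mod_cast h
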